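/- arXiv:2309.13678 — 2 statements merged into one kernel-verified Lean document; each statement's English description precedes it below -/
import Mathlib

section
/- For every positive integer n and k = ⌊n/2⌋, one has E_k(n) ≤ 7; that is, there exists a Boolean function f from the k-element subsets of [n] to {0,1} whose deterministic query complexity D_k(f) is at least n − 7. -/
/-- A (binary) decision tree over ground set `[n]` (positions `Fin n`):
leaves are labelled with a Boolean output, inner nodes with a query `i ∈ [n]`;
the left subtree corresponds to the answer `i ∉ A`, the right one to `i ∈ A`. -/
inductive DecTree (n : ℕ) : Type
  | leaf : Bool → DecTree n
  | node : Fin n → DecTree n → DecTree n → DecTree n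

namespace DecTree

/-- The height (depth) of a decision tree: the maximum number of queries on a
root-to-leaf path. -/
def depth {n : ℕ} : DecTree n → ℕ
  | leaf _ => 0
  | node _ t0 t1 => max (depth t0) (depth t1) + 1

/-- Evaluate a decision tree on an input set `A ⊆ [n]`. -/
def eval {n : ℕ} : DecTree n → Finset (Fin n) → Bool
  | leaf b, _ => b
  | node i t0 t1, A => if i ∈ A then eval t1 A else eval t0 A

end DecTree

/-- The slice: the `k`-element subsets of `[n]`. -/
def Slice (n k : ℕ) : Type := {A : Finset (Fin n) // A.card = k}

/-- A decision tree computes `f` on the slice if it evaluates to `f A` for every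
`A` in the slice. -/
def Computes {n k : ℕ} (T : DecTree n) (f : Slice n k → Bool) : Prop :=
  ∀ A : Slice n k, T.eval A.val = f A

/-- Deterministic query complexity of `f` on the slice: the minimum height of a
decision tree computing `f`. -/
noncomputable def Dquery (n k : ℕ) (f : Slice n k → Bool) : ℕ :=
  sInf {d : ℕ | ∃ T : DecTree n, T.depth ≤ d ∧ Computes T f}

/-- `Dmax n k`: the maximum deterministic query complexity over all Boolean
functions on the slice of `k`-subsets of `[n]`. -/
noncomputable def Dmax (n k : ℕ) : ℕ :=
  sSup {d : ℕ | ∃ f : Slice n k → Bool, Dquery n k f = d}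

/-- `Equery n k = n - Dmax n k`. -/
noncomputable def Equery (n k : ℕ) : ℕ := n - Dmax n k

open Finset

namespace DecTree

/-- Every function of the input set is evaluated by some decision tree. -/
theorem exists_eval_eq_inter {n : ℕ} (S : Finset (Fin n)) :
    ∀ g : Finset (Fin n) → Bool, ∃ T : DecTree n, ∀ A, T.eval A = g (A ∩ S) := by
  induction S using Finset.induction_on with
  | empty => exact fun g => ⟨leaf (g ∅), fun A => by simp [eval]⟩
  | insert i S _ ih =>
    intro g
    obtain ⟨T₀, h₀⟩ := ih g
    obtain ⟨T₁, h₁⟩ := ih fun A => g (insert i A)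
    refine ⟨node i T₀ T₁, fun A => ?_⟩
    by_cases hA : i ∈ A
    · simp [eval, hA, h₁, Finset.inter_insert_of_mem hA]
    · simp [eval, hA, h₀, Finset.inter_insert_of_notMem hA]

/-- An upper bound for the number of Boolean functions on the `j`-subsets of a set with `r + 8`
elements that are computed by decision trees of depth at most `r`. -/
def countBound : ℕ → ℕ → ℕ
  | 0, _ => 2
  | _ + 1, 0 => 2
  | r + 1, j + 1 =>
    if r + 9 ≤ j + 1 then 2 else (r + 9) * (countBound r j * countBound r (j + 1))

theorem pow_four_le_two_pow {m : ℕ} (hm : 9 ≤ m) : m ^ 4 ≤ 2 ^ (m + 4) := by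
  induction m, hm using Nat.le_induction with
  | base => norm_num
  | succ m hm ih =>
    have h : (m + 1) ^ 4 ≤ 2 * m ^ 4 := by
      obtain ⟨t, rfl⟩ := Nat.exists_eq_add_of_le hm
      ring_nf
      nlinarith [Nat.zero_le t, Nat.zero_le (t ^ 2), Nat.zero_le (t ^ 3), Nat.zero_le (t ^ 4)]
    calc (m + 1) ^ 4 ≤ 2 * m ^ 4 := h
      _ ≤ 2 * 2 ^ (m + 4) := by gcongr
      _ = 2 ^ (m + 1 + 4) := by ring

theorem linear_le_choose_three (r : ℕ) : 16 * (r + 8) + 160 ≤ (r + 14).choose 3 := by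
  induction r with
  | zero => decide
  | succ r ih =>
    have h : (r + 14).choose 1 ≤ (r + 14).choose 2 := by
      apply Nat.choose_le_succ_of_lt_half_left
      omega
    have h₁ : (r + 1 + 14).choose 3 = (r + 14).choose 2 + (r + 14).choose 3 :=
      Nat.choose_succ_succ _ _
    have h₂ : (r + 14).choose 2 = (r + 13).choose 1 + (r + 13).choose 2 :=
      Nat.choose_succ_succ _ _
    have h₃ : (r + 13).choose 1 ≤ (r + 13).choose 2 := by
      apply Nat.choose_le_succ_of_lt_half_left
      omega
    simp only [Nat.choose_one_right] at h₃ h₂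
    omega

theorem countBound_pow_le (r : ℕ) : ∀ j, j ≤ r + 8 →
    countBound r j ^ 64 * 2 ^ (16 * (r + 8) + 96) ≤ 2 ^ (r + 14).choose (j + 3) := by
  have key : ∀ {r c : ℕ}, 16 * (r + 8) + 160 ≤ c → 2 ^ 64 * 2 ^ (16 * (r + 8) + 96) ≤ 2 ^ c := by
    intro r c h
    rw [← pow_add]
    exact Nat.pow_le_pow_right (by norm_num) (by omega)
  induction r with
  | zero =>
    intro j hj
    rw [countBound]
    refine key ?_
    interval_cases j <;> decide
  | succ r ih =>
    rintro (_ | j) hj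
    · rw [countBound]
      exact key (linear_le_choose_three _)
    · rw [countBound]
      split_ifs with hr
      · refine key ((linear_le_choose_three _).trans_eq ?_)
        exact Nat.choose_symm_of_eq_add (by omega)
      · have h₁ := ih j (by omega)
        have h₀ := ih (j + 1) (by omega)
        have hm : (r + 9) ^ 64 ≤ 2 ^ (16 * (r + 9) + 64) := by
          calc (r + 9) ^ 64 = ((r + 9) ^ 4) ^ 16 := by rw [← pow_mul]
            _ ≤ (2 ^ (r + 9 + 4)) ^ 16 :=
              Nat.pow_le_pow_left (pow_four_le_two_pow (by omega)) 16
            _ = 2 ^ (16 * (r + 9) + 64) := by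
              rw [← pow_mul, show (r + 9 + 4) * 16 = 16 * (r + 9) + 64 by ring]
        set a := countBound r j
        set b := countBound r (j + 1)
        calc ((r + 9) * (a * b)) ^ 64 * 2 ^ (16 * (r + 1 + 8) + 96)
            = (r + 9) ^ 64 * (a ^ 64 * b ^ 64 * 2 ^ (16 * (r + 1 + 8) + 96)) := by
              rw [mul_pow, mul_pow, mul_assoc]
          _ ≤ 2 ^ (16 * (r + 9) + 64) * (a ^ 64 * b ^ 64 * 2 ^ (16 * (r + 1 + 8) + 96)) := by
              gcongr
          _ = (a ^ 64 * 2 ^ (16 * (r + 8) + 96)) * (b ^ 64 * 2 ^ (16 * (r + 8) + 96)) := by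
              have h : 2 ^ (16 * (r + 9) + 64) * 2 ^ (16 * (r + 1 + 8) + 96)
                  = 2 ^ (16 * (r + 8) + 96) * 2 ^ (16 * (r + 8) + 96) := by
                rw [← pow_add, ← pow_add]; congr 1; ring
              calc _ = a ^ 64 * b ^ 64 *
                    (2 ^ (16 * (r + 9) + 64) * 2 ^ (16 * (r + 1 + 8) + 96)) := by
                    simp only [mul_comm, mul_left_comm, mul_assoc]
                _ = _ := by rw [h]; simp only [mul_comm, mul_left_comm, mul_assoc]
          _ ≤ 2 ^ (r + 14).choose (j + 3) * 2 ^ (r + 14).choose (j + 1 + 3) := by gcongr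
          _ = 2 ^ (r + 1 + 14).choose (j + 1 + 3) := by
              rw [← pow_add, ← Nat.choose_succ_succ]

theorem choose_add_two_middle_le (n : ℕ) :
    (n + 2).choose (n / 2 + 1) ≤ 4 * n.choose (n / 2) := by
  have h₁ := Nat.choose_le_middle (n / 2 + 1) n
  have h₂ : (n + 2).choose (n / 2 + 1) = (n + 1).choose (n / 2) + (n + 1).choose (n / 2 + 1) :=
    Nat.choose_succ_succ _ _
  have h₃ : (n + 1).choose (n / 2 + 1) = n.choose (n / 2) + n.choose (n / 2 + 1) :=
    Nat.choose_succ_succ _ _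
  have h₄ : (n + 1).choose (n / 2) ≤ 2 * n.choose (n / 2) := by
    rcases hk : n / 2 with _ | t
    · simp
    · have h₅ : (n + 1).choose (t + 1) = n.choose t + n.choose (t + 1) :=
        Nat.choose_succ_succ _ _
      have h₆ := Nat.choose_le_middle t n
      rw [hk] at h₆
      omega
  omega

theorem countBound_lt {n : ℕ} (hn : 8 ≤ n) :
    countBound (n - 8) (n / 2) < 2 ^ n.choose (n / 2) := by
  obtain ⟨r, rfl⟩ := Nat.exists_eq_add_of_le' hn
  set m := r + 8 with hm
  have h := countBound_pow_le r (m / 2) (by omega)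
  have h₁ := choose_add_two_middle_le m
  have h₂ := choose_add_two_middle_le (m + 2)
  have h₃ := choose_add_two_middle_le (m + 4)
  rw [show (m + 2) / 2 = m / 2 + 1 by omega] at h₂
  rw [show (m + 4) / 2 = m / 2 + 2 by omega] at h₃
  have hc : (r + 14).choose (m / 2 + 3) ≤ 64 * m.choose (m / 2) := by
    have e₁ : (r + 14).choose (m / 2 + 3) = (m + 4 + 2).choose (m / 2 + 2 + 1) := rfl
    have e₂ : (m + 2 + 2).choose (m / 2 + 1 + 1) = (m + 4).choose (m / 2 + 2) := rfl
    omega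
  rw [show m - 8 = r by omega]
  refine lt_of_pow_lt_pow_left₀ 64 (Nat.zero_le _) ?_
  rcases (Nat.eq_zero_or_pos (countBound r (m / 2) ^ 64)).symm with hpos | h0
  · calc countBound r (m / 2) ^ 64
        < countBound r (m / 2) ^ 64 * 2 ^ (16 * (r + 8) + 96) :=
          lt_mul_of_one_lt_right hpos (Nat.one_lt_two_pow (by omega))
      _ ≤ 2 ^ (r + 14).choose (m / 2 + 3) := h
      _ ≤ 2 ^ (64 * m.choose (m / 2)) := Nat.pow_le_pow_right (by norm_num) hc
      _ = (2 ^ m.choose (m / 2)) ^ 64 := by rw [← pow_mul, mul_comm]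
  · rw [h0]; positivity

/-- If at most one `j`-subset of `S` exists, the two constant functions represent all functions
on the `j`-subsets of `S`. -/
theorem exists_cover_of_card_le_one {n : ℕ} (S B : Finset (Fin n)) (j : ℕ)
    (h : (S.powersetCard j).card ≤ 1) :
    ∃ P : Finset (Finset (Fin n) → Bool), P.card ≤ 2 ∧ ∀ T : DecTree n,
      ∃ g ∈ P, ∀ A ∈ S.powersetCard j, T.eval (B ∪ A) = g A := by
  refine ⟨{fun _ => false, fun _ => true}, Finset.card_le_two, fun T => ?_⟩
  have hc : ∃ b : Bool, ∀ A ∈ S.powersetCard j, T.eval (B ∪ A) = b := by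
    rcases (S.powersetCard j).eq_empty_or_nonempty with h0 | ⟨A, hA⟩
    · exact ⟨true, by simp [h0]⟩
    · exact ⟨T.eval (B ∪ A), fun A' hA' => by rw [Finset.card_le_one.mp h A hA A' hA']⟩
  obtain ⟨b, hb⟩ := hc
  exact ⟨fun _ => b, by cases b <;> simp, hb⟩

/-- A tree of depth at most `r + 1` is, on the subsets of `S`, a query to an element of `S`
followed by trees of depth at most `r`. -/
theorem exists_query_mem {n r : ℕ} {S B : Finset (Fin n)} (hS : S.Nonempty) (T : DecTree n)
    (hT : T.depth ≤ r + 1) :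
    ∃ i ∈ S, ∃ T₀ T₁ : DecTree n, T₀.depth ≤ r ∧ T₁.depth ≤ r ∧
      ∀ A ⊆ S, T.eval (B ∪ A) = if i ∈ B ∪ A then T₁.eval (B ∪ A) else T₀.eval (B ∪ A) := by
  induction T with
  | leaf b =>
    obtain ⟨i, hi⟩ := hS
    exact ⟨i, hi, leaf b, leaf b, Nat.zero_le _, Nat.zero_le _, fun A _ => by simp [eval]⟩
  | node i T₀ T₁ ih₀ ih₁ =>
    simp only [depth, add_le_add_iff_right, max_le_iff] at hT
    by_cases hi : i ∈ S
    · exact ⟨i, hi, T₀, T₁, hT.1, hT.2, fun A _ => rfl⟩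
    · by_cases hB : i ∈ B
      · obtain ⟨i', hi', U₀, U₁, h₀, h₁, hU⟩ := ih₁ (by omega)
        refine ⟨i', hi', U₀, U₁, h₀, h₁, fun A hA => ?_⟩
        rw [← hU A hA, eval, if_pos (Finset.mem_union_left _ hB)]
      · obtain ⟨i', hi', U₀, U₁, h₀, h₁, hU⟩ := ih₀ (by omega)
        refine ⟨i', hi', U₀, U₁, h₀, h₁, fun A hA => ?_⟩
        have hiA : i ∉ B ∪ A := by
          rw [Finset.mem_union, not_or]
          exact ⟨hB, fun h => hi (hA h)⟩
        rw [← hU A hA, eval, if_neg hiA]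

/-- The functions on the `j`-subsets of `S` computed by trees of depth at most `r`, once the set
`B` of elements outside `S` is known to be in the input, are represented by at most
`countBound r j` functions. -/
theorem exists_cover {n : ℕ} (r : ℕ) : ∀ (j : ℕ) (S B : Finset (Fin n)), S.card = r + 8 →
    Disjoint B S → ∃ P : Finset (Finset (Fin n) → Bool), P.card ≤ countBound r j ∧
      ∀ T : DecTree n, T.depth ≤ r → ∃ g ∈ P, ∀ A ∈ S.powersetCard j, T.eval (B ∪ A) = g A := by
  induction r with
  | zero =>
    intro j S B _ _
    refine ⟨{fun _ => false, fun _ => true}, Finset.card_le_two, fun T hT => ?_⟩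
    cases T with
    | leaf b => exact ⟨fun _ => b, by cases b <;> simp, fun A _ => rfl⟩
    | node i T₀ T₁ => simp [depth] at hT
  | succ r ih =>
    rintro (_ | j) S B hS hB
    · obtain ⟨P, hP, h⟩ := exists_cover_of_card_le_one S B 0 (by simp)
      exact ⟨P, by rwa [countBound], fun T _ => h T⟩
    rw [countBound]
    split_ifs with hr
    · obtain ⟨P, hP, h⟩ := exists_cover_of_card_le_one S B (j + 1) (by
        rw [Finset.card_powersetCard]
        rcases hr.eq_or_lt with hr | hr
        · rw [← hr, hS, Nat.choose_self]
        · rw [Nat.choose_eq_zero_of_lt (by omega)]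
          exact zero_le_one)
      exact ⟨P, hP, fun T _ => h T⟩
    have hcover₀ : ∀ i : Fin n, ∃ P : Finset (Finset (Fin n) → Bool), i ∈ S →
        P.card ≤ countBound r (j + 1) ∧ ∀ T : DecTree n, T.depth ≤ r →
          ∃ g ∈ P, ∀ A ∈ (S.erase i).powersetCard (j + 1), T.eval (B ∪ A) = g A := by
      intro i
      by_cases hi : i ∈ S
      · obtain ⟨P, hP⟩ := ih (j + 1) (S.erase i) B
          (by rw [Finset.card_erase_of_mem hi]; omega)
          (hB.mono_right (Finset.erase_subset _ _))
        exact ⟨P, fun _ => hP⟩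
      · exact ⟨∅, fun h => absurd h hi⟩
    have hcover₁ : ∀ i : Fin n, ∃ P : Finset (Finset (Fin n) → Bool), i ∈ S →
        P.card ≤ countBound r j ∧ ∀ T : DecTree n, T.depth ≤ r →
          ∃ g ∈ P, ∀ A ∈ (S.erase i).powersetCard j, T.eval (insert i B ∪ A) = g A := by
      intro i
      by_cases hi : i ∈ S
      · obtain ⟨P, hP⟩ := ih j (S.erase i) (insert i B)
          (by rw [Finset.card_erase_of_mem hi]; omega)
          (Finset.disjoint_insert_left.mpr
            ⟨Finset.notMem_erase _ _, hB.mono_right (Finset.erase_subset _ _)⟩)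
        exact ⟨P, fun _ => hP⟩
      · exact ⟨∅, fun h => absurd h hi⟩
    choose P₀ hP₀ using hcover₀
    choose P₁ hP₁ using hcover₁
    let glue (i : Fin n) (g : (Finset (Fin n) → Bool) × (Finset (Fin n) → Bool)) :
        Finset (Fin n) → Bool := fun A => if i ∈ A then g.1 (A.erase i) else g.2 A
    refine ⟨S.biUnion fun i => (P₁ i ×ˢ P₀ i).image (glue i), ?_, fun T hT => ?_⟩
    · refine (Finset.card_biUnion_le_card_mul _ _ (countBound r j * countBound r (j + 1))
        fun i hi => ?_).trans_eq (by rw [hS])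
      refine Finset.card_image_le.trans ?_
      rw [Finset.card_product]
      exact Nat.mul_le_mul (hP₁ i hi).1 (hP₀ i hi).1
    · obtain ⟨i, hi, T₀, T₁, hT₀, hT₁, hT'⟩ :=
        exists_query_mem (B := B) (Finset.card_pos.mp (by omega : 0 < S.card)) T hT
      obtain ⟨g₀, hg₀, h₀⟩ := (hP₀ i hi).2 T₀ hT₀
      obtain ⟨g₁, hg₁, h₁⟩ := (hP₁ i hi).2 T₁ hT₁
      have hiB : i ∉ B := fun h => Finset.disjoint_left.mp hB h hi
      refine ⟨glue i (g₁, g₀), Finset.mem_biUnion.mpr ⟨i, hi, Finset.mem_image_of_mem _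
        (Finset.mem_product.mpr ⟨hg₁, hg₀⟩)⟩, fun A hA => ?_⟩
      rw [Finset.mem_powersetCard] at hA
      rw [hT' A hA.1]
      by_cases hiA : i ∈ A
      · rw [if_pos (Finset.mem_union_right _ hiA)]
        have h := h₁ (A.erase i) (Finset.mem_powersetCard.mpr
          ⟨Finset.erase_subset_erase _ hA.1, by rw [Finset.card_erase_of_mem hiA]; omega⟩)
        rw [Finset.insert_union, ← Finset.union_insert, Finset.insert_erase hiA] at h
        simpa [glue, hiA] using h
      · rw [if_neg (by simp [hiA, hiB])]
        have h := h₀ A (Finset.mem_powersetCard.mpr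
          ⟨Finset.subset_erase.mpr ⟨hA.1, hiA⟩, hA.2⟩)
        simpa [glue, hiA] using h

end DecTree

instance (n k : ℕ) : Fintype (Slice n k) :=
  inferInstanceAs (Fintype {A : Finset (Fin n) // A.card = k})

theorem card_slice (n k : ℕ) : Fintype.card (Slice n k) = n.choose k :=
  (Fintype.card_finset_len k).trans (by rw [Fintype.card_fin])

theorem exists_computes_depth_le_Dquery {n k : ℕ} (f : Slice n k → Bool) :
    ∃ T : DecTree n, T.depth ≤ Dquery n k f ∧ Computes T f := by
  refine Nat.sInf_mem (s := {d | ∃ T : DecTree n, T.depth ≤ d ∧ Computes T f}) ?_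
  classical
  obtain ⟨T, hT⟩ := DecTree.exists_eval_eq_inter Finset.univ
    fun A : Finset (Fin n) => if h : A.card = k then f ⟨A, h⟩ else false
  refine ⟨T.depth, T, le_rfl, fun A => ?_⟩
  rw [hT, Finset.inter_univ, dif_pos A.property]
  rfl

theorem exists_le_Dquery (n : ℕ) : ∃ f : Slice n (n / 2) → Bool, n - 7 ≤ Dquery n (n / 2) f := by
  rcases lt_or_ge n 8 with hn | hn
  · exact ⟨fun _ => false, by omega⟩
  by_contra! hcon
  obtain ⟨P, hP, hcover⟩ := DecTree.exists_cover (n - 8) (n / 2) (Finset.univ : Finset (Fin n)) ∅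
    (by rw [Finset.card_univ, Fintype.card_fin]; omega) (Finset.disjoint_empty_left _)
  have hrep : ∀ f : Slice n (n / 2) → Bool, ∃ g ∈ P, ∀ A, f A = g A.val := by
    intro f
    obtain ⟨T, hT, hf⟩ := exists_computes_depth_le_Dquery f
    obtain ⟨g, hg, h⟩ := hcover T (by have := hcon f; omega)
    refine ⟨g, hg, fun A => ?_⟩
    rw [← hf A, ← h A.val (by simpa using A.property), Finset.empty_union]
  choose G hG hGf using hrep
  have hinj : Function.Injective fun f => (⟨G f, hG f⟩ : P) := by
    intro f f' h
    funext A
    exact (hGf f A).trans ((congrFun (congrArg Subtype.val h) _).trans (hGf f' A).symm)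
  have hcard := Nat.card_le_card_of_injective _ hinj
  rw [Nat.card_fun, Nat.card_eq_fintype_card, Nat.card_eq_fintype_card, Nat.card_eq_fintype_card,
    Fintype.card_bool, card_slice, Fintype.card_coe] at hcard
  exact absurd (hcard.trans hP) (DecTree.countBound_lt hn).not_ge

theorem Dquery_le_Dmax {n k : ℕ} (f : Slice n k → Bool) : Dquery n k f ≤ Dmax n k :=
  le_csSup (Set.finite_range (Dquery n k)).bddAbove ⟨f, rfl⟩

/-- For every positive integer `n` and `k = ⌊n/2⌋`, one has `E_k(n) ≤ 7`:
there is a Boolean function on the middle slice with query complexity `≥ n - 7`. -/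
theorem stmt_0 (n : ℕ) (hn : 0 < n) :
    Equery n (n / 2) ≤ 7 ∧
    ∃ f : Slice n (n / 2) → Bool, n - 7 ≤ Dquery n (n / 2) f := by
  obtain ⟨f, hf⟩ := exists_le_Dquery n
  have := Dquery_le_Dmax f
  exact ⟨by rw [Equery]; omega, f, hf⟩
end

section
/- For every real number α with 0 < α < 1/2 there exist a constant C = C_α and a threshold N such that for all integers n ≥ N, setting k = ⌊αn⌋, one has Σ_{ℓ=C}^{n} log₂(ℓ) · Σ_{i=max(0, k−ℓ)}^{k} binom(n−ℓ, i) < binom(n, k). -/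
theorem sum_choose_succ_add_choose (m k : ℕ) :
    ∑ i ∈ Finset.range (k + 1), (m + 1).choose i + m.choose k =
      2 * ∑ i ∈ Finset.range (k + 1), m.choose i := by
  induction k with
  | zero => simp
  | succ k ih =>
    rw [Finset.sum_range_succ, Finset.sum_range_succ _ (k + 1), Nat.choose_succ_succ']
    omega

theorem mul_choose_succ_le_choose {c : ℝ} {m n j : ℕ} (hn : 0 < n) (hmn : m ≤ n)
    (hc : c * n ≤ j + 1) : c * m.choose (j + 1) ≤ m.choose j := by
  have h : (m.choose (j + 1) : ℝ) * (j + 1) = m.choose j * (m - j : ℕ) := by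
    exact_mod_cast Nat.choose_succ_right_eq m j
  have hmj : ((m - j : ℕ) : ℝ) ≤ n := by exact_mod_cast (Nat.sub_le m j).trans hmn
  have hn' : (0 : ℝ) < n := by exact_mod_cast hn
  refine le_of_mul_le_mul_right ?_ hn'
  calc c * m.choose (j + 1) * n = m.choose (j + 1) * (c * n) := by ring
    _ ≤ m.choose (j + 1) * (j + 1) := by gcongr
    _ = m.choose j * (m - j : ℕ) := h
    _ ≤ m.choose j * n := by gcongr

theorem one_add_mul_choose_le_sum_choose {c : ℝ} {m n k : ℕ} (hn : 0 < n) (hmn : m ≤ n)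
    (hk : 0 < k) (hc : c * n ≤ k) :
    (1 + c) * m.choose k ≤ ∑ i ∈ Finset.range (k + 1), (m.choose i : ℝ) := by
  obtain ⟨j, rfl⟩ := Nat.exists_eq_add_of_lt hk
  simp only [zero_add] at *
  have h := mul_choose_succ_le_choose hn hmn (by exact_mod_cast hc : c * n ≤ j + 1)
  have h0 : 0 ≤ ∑ i ∈ Finset.range j, (m.choose i : ℝ) := by positivity
  rw [Finset.sum_range_succ, Finset.sum_range_succ]
  linarith

theorem sum_choose_le_mul_sum_choose_succ {c : ℝ} {m n k : ℕ} (hc0 : 0 < c) (hn : 0 < n)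
    (hmn : m ≤ n) (hk : 0 < k) (hc : c * n ≤ k) :
    ∑ i ∈ Finset.range (k + 1), (m.choose i : ℝ) ≤
      (1 + c) / (1 + 2 * c) * ∑ i ∈ Finset.range (k + 1), ((m + 1).choose i : ℝ) := by
  have h := one_add_mul_choose_le_sum_choose hn hmn hk hc
  have hrec : ∑ i ∈ Finset.range (k + 1), ((m + 1).choose i : ℝ) + m.choose k =
      2 * ∑ i ∈ Finset.range (k + 1), (m.choose i : ℝ) := by
    exact_mod_cast sum_choose_succ_add_choose m k
  rw [div_mul_eq_mul_div, le_div_iff₀ (by positivity), eq_sub_of_add_eq hrec]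
  linarith

theorem sum_choose_sub_le_pow_mul {c : ℝ} {n k : ℕ} (hc0 : 0 < c) (hn : 0 < n)
    (hk : 0 < k) (hc : c * n ≤ k) {l : ℕ} (hl : l ≤ n) :
    ∑ i ∈ Finset.range (k + 1), ((n - l).choose i : ℝ) ≤
      ((1 + c) / (1 + 2 * c)) ^ l * ∑ i ∈ Finset.range (k + 1), (n.choose i : ℝ) := by
  induction l with
  | zero => simp
  | succ l ih =>
    have h := sum_choose_le_mul_sum_choose_succ hc0 hn (Nat.sub_le n (l + 1)) hk hc
    rw [show n - (l + 1) + 1 = n - l by omega] at h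
    refine h.trans ?_
    rw [pow_succ', mul_assoc]
    gcongr
    exact ih (by omega)

theorem one_sub_mul_sum_choose_le {ρ : ℝ} (hρ : 0 ≤ ρ) {n k : ℕ}
    (h : (k : ℝ) ≤ ρ * (n - k)) :
    (1 - ρ) * ∑ i ∈ Finset.range (k + 1), (n.choose i : ℝ) ≤ n.choose k := by
  induction k with
  | zero => simpa using hρ
  | succ k ih =>
    push_cast at h
    have hk : (k : ℝ) + 1 ≤ ρ * (n - k) := by linarith
    have hpos : (0 : ℝ) < ρ * (n - k) := (by positivity : (0 : ℝ) < k + 1).trans_le hk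
    have hkn : (0 : ℝ) < n - k := pos_of_mul_pos_right hpos hρ
    have hkn' : k ≤ n := by
      have : (k : ℝ) ≤ n := by linarith
      exact_mod_cast this
    have hch : (n.choose (k + 1) : ℝ) * (k + 1) = n.choose k * (n - k) := by
      rw [← Nat.cast_sub hkn']
      exact_mod_cast Nat.choose_succ_right_eq n k
    have hle : (n.choose k : ℝ) ≤ ρ * n.choose (k + 1) := by
      refine le_of_mul_le_mul_right ?_ hkn
      calc (n.choose k : ℝ) * (n - k) = n.choose (k + 1) * (k + 1) := hch.symm
        _ ≤ n.choose (k + 1) * (ρ * (n - k)) := by gcongr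
        _ = ρ * n.choose (k + 1) * (n - k) := by ring
    have := ih (by linarith)
    rw [Finset.sum_range_succ]
    linarith

theorem logb_two_natCast_le (l : ℕ) : Real.logb 2 l ≤ l := by
  rcases l.eq_zero_or_pos with rfl | hl
  · simp
  · rw [Real.logb_le_iff_le_rpow one_lt_two (by exact_mod_cast hl), Real.rpow_natCast]
    exact_mod_cast Nat.lt_two_pow_self.le

theorem exists_forall_sum_Icc_lt {f : ℕ → ℝ} (hf : Summable f) {ε : ℝ} (hε : 0 < ε) :
    ∃ C : ℕ, ∀ n, ∑ l ∈ Finset.Icc C n, f l < ε := by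
  obtain ⟨s, hs⟩ := summable_iff_vanishing_norm.1 hf ε hε
  refine ⟨s.sup id + 1, fun n => (le_abs_self _).trans_lt (hs _ ?_)⟩
  refine Finset.disjoint_left.2 fun x hx hxs => ?_
  have := Finset.le_sup (f := id) hxs
  simp only [Finset.mem_Icc, id] at *
  omega

/-- For every real `0 < α < 1/2` there exist a constant `C` and a threshold `N`
such that for all `n ≥ N`, with `k = ⌊α n⌋`,
`Σ_{ℓ=C}^n log₂(ℓ) · Σ_{i=max(0,k-ℓ)}^{k} binom(n-ℓ, i) < binom(n, k)`
(binomial coefficients vanish out of range; `k - ℓ` is truncated ℕ-subtraction,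
i.e. `max (k - ℓ) 0`). -/
theorem stmt_8 (α : ℝ) (hα0 : 0 < α) (hα1 : α < 1 / 2) :
    ∃ C N : ℕ, ∀ n : ℕ, N ≤ n →
      (∑ ℓ ∈ Finset.Icc C n,
          Real.logb 2 ℓ *
            ∑ i ∈ Finset.Icc (⌊α * n⌋₊ - ℓ) ⌊α * n⌋₊, (Nat.choose (n - ℓ) i : ℝ))
        < (Nat.choose n ⌊α * n⌋₊ : ℝ) := by
  set c : ℝ := α / 2 with hc_def
  set r : ℝ := (1 + c) / (1 + 2 * c) with hr_def
  set ρ : ℝ := α / (1 - α) with hρ_def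
  have hc0 : 0 < c := by positivity
  have hr0 : 0 ≤ r := by positivity
  have hr1 : r < 1 := by rw [hr_def, div_lt_one (by positivity)]; linarith
  have hα1' : 0 < 1 - α := by linarith
  have hρ0 : 0 ≤ ρ := by positivity
  have hρ1 : 0 < 1 - ρ := by
    rw [sub_pos, hρ_def, div_lt_one hα1']; linarith
  have hsum : Summable fun l : ℕ => (l : ℝ) * r ^ l := by
    simpa using summable_pow_mul_geometric_of_norm_lt_one 1
      (by rwa [Real.norm_of_nonneg hr0] : ‖r‖ < 1)
  obtain ⟨C, hC⟩ := exists_forall_sum_Icc_lt hsum hρ1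
  refine ⟨C, ⌈2 / α⌉₊, fun n hn => ?_⟩
  have hn2 : 2 ≤ α * n := by
    rw [← div_le_iff₀' hα0]
    exact Nat.ceil_le.1 hn
  have hn0 : 0 < n := by
    rcases n.eq_zero_or_pos with rfl | h
    · norm_num at hn2
    · exact h
  set k : ℕ := ⌊α * n⌋₊ with hk_def
  have hkle : (k : ℝ) ≤ α * n := Nat.floor_le (by positivity)
  have hklt : α * n < k + 1 := Nat.lt_floor_add_one _
  have hck : c * n ≤ k := by rw [hc_def]; linarith
  have hk0 : 0 < k := Nat.floor_pos.2 (by linarith)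
  have hkn : k ≤ n := by
    have : (k : ℝ) ≤ n := hkle.trans (mul_le_of_le_one_left (by positivity) (by linarith))
    exact_mod_cast this
  have hρk : (k : ℝ) ≤ ρ * (n - k) := by
    rw [hρ_def, div_mul_eq_mul_div, le_div_iff₀ hα1']
    linarith
  have hpos : (0 : ℝ) < n.choose k := by exact_mod_cast Nat.choose_pos hkn
  set B : ℝ := ∑ i ∈ Finset.range (k + 1), (n.choose i : ℝ) with hB_def
  have hBle : (1 - ρ) * B ≤ n.choose k := one_sub_mul_sum_choose_le hρ0 hρk
  have hB0 : 0 < B :=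
    Finset.sum_pos' (fun _ _ => by positivity) ⟨k, Finset.self_mem_range_succ k, hpos⟩
  calc ∑ l ∈ Finset.Icc C n, Real.logb 2 l *
          ∑ i ∈ Finset.Icc (k - l) k, ((n - l).choose i : ℝ)
      ≤ ∑ l ∈ Finset.Icc C n, (l * r ^ l) * B := by
        refine Finset.sum_le_sum fun l hl => ?_
        rw [mul_assoc]
        refine mul_le_mul (logb_two_natCast_le l) ?_ (by positivity) (by positivity)
        refine (Finset.sum_le_sum_of_subset_of_nonneg ?_ fun _ _ _ => by positivity).trans
          (sum_choose_sub_le_pow_mul hc0 hn0 hk0 hck (Finset.mem_Icc.1 hl).2)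
        intro i hi
        simp only [Finset.mem_Icc, Finset.mem_range] at *
        omega
    _ = (∑ l ∈ Finset.Icc C n, l * r ^ l) * B := (Finset.sum_mul ..).symm
    _ < (1 - ρ) * B := by gcongr; exact hC n
    _ ≤ n.choose k := hBle
end
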